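/- The 4-coloring complex B(Q_1) of the 12-vertex graph Q_1 has exactly three connected components; the proper 4-colorings whose color classes lie in exactly one of these components are all odd, and the proper 4-colorings whose color classes lie in either of the other two components are all even. -/

import Mathlib

/-- A proper 4-coloring of a simple graph `G`. -/
def IsProperColoring {V : Type*} (G : SimpleGraph V) (f : V → Fin 4) : Prop :=
  ∀ ⦃u v : V⦄, G.Adj u v → f u ≠ f v

/-- `kempeCount G f a b` is the number of `ab`-Kempe chains of `f`, i.e. the number of
connected components of the subgraph of `G` induced on `f⁻¹({a, b})`. -/
noncomputable def kempeCount {V : Type*} (G : SimpleGraph V) (f : V → Fin 4)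
    (a b : Fin 4) : ℕ :=
  Nat.card ((G.induce {v | f v = a ∨ f v = b}).ConnectedComponent)

/-- Tutte's quantity `J_a(f) = p(a,b) + p(a,c) + p(a,d) - p(b,c) - p(b,d) - p(c,d)`,
where `{b, c, d} = Fin 4 \ {a}`. -/
noncomputable def Jcol {V : Type*} (G : SimpleGraph V) (f : V → Fin 4) (a : Fin 4) : ℤ :=
  (∑ x ∈ Finset.univ.erase a, (kempeCount G f a x : ℤ)) -
    ∑ x ∈ Finset.univ.erase a,
      ∑ y ∈ (Finset.univ.erase a).filter (fun y => x < y), (kempeCount G f x y : ℤ)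

/-- The coloring-partition of `f`: the set of its nonempty color classes. -/
def colPart {V : Type*} (f : V → Fin 4) : Set (Set V) :=
  {A | A.Nonempty ∧ ∃ c, A = f ⁻¹' {c}}

/-- `P` is a coloring-partition of `G` if it is the coloring-partition of some proper
4-coloring of `G`. -/
def IsColoringPartition {V : Type*} (G : SimpleGraph V) (P : Set (Set V)) : Prop :=
  ∃ f, IsProperColoring G f ∧ P = colPart f

/-- The set of all color classes of proper 4-colorings of `G`. -/
def colorClasses {V : Type*} (G : SimpleGraph V) : Set (Set V) :=
  {A | A.Nonempty ∧ ∃ f c, IsProperColoring G f ∧ A = f ⁻¹' {c}}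

/-- The 4-coloring complex `B(G)`: vertices are color classes of proper 4-colorings of `G`,
two distinct classes being adjacent iff they are color classes of a common proper
4-coloring. -/
def colorComplex {V : Type*} (G : SimpleGraph V) : SimpleGraph (colorClasses G) :=
  SimpleGraph.fromRel (fun A B => ∃ f, IsProperColoring G f ∧
    (∃ c, (A : Set V) = f ⁻¹' {c}) ∧ (∃ c, (B : Set V) = f ⁻¹' {c}))

/-- Two proper 4-colorings are adjacent if they have a common (nonempty) color class. -/
def ColAdj {V : Type*} (G : SimpleGraph V) (f g : V → Fin 4) : Prop :=
  IsProperColoring G f ∧ IsProperColoring G g ∧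
    ∃ c c', (f ⁻¹' {c}).Nonempty ∧ f ⁻¹' {c} = g ⁻¹' {c'}

/-- Generating relation for the triangulation `Q_k`.  The vertex `(i, 0)` is `a_i`,
`(i, 1)` is `b_i`, `(i, 2)` is `c_i` and `(i, 3)` is `d_i`.  Edges: the 4-cycles
`a_i b_i c_i d_i`, connecting edges between consecutive cycles, and the chords
`a_0 c_0` and `a_{k+1} c_{k+1}`. -/
def qkRel (k : ℕ) (u v : Fin (k + 2) × Fin 4) : Prop :=
  (u.1 = v.1 ∧ v.2 = u.2 + 1) ∨
  ((v.1 : ℕ) = (u.1 : ℕ) + 1 ∧ (v.2 = u.2 ∨ v.2 = u.2 + 1)) ∨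
  ((u.1 : ℕ) = 0 ∧ (v.1 : ℕ) = 0 ∧ u.2 = 0 ∧ v.2 = 2) ∨
  ((u.1 : ℕ) = k + 1 ∧ (v.1 : ℕ) = k + 1 ∧ u.2 = 0 ∧ v.2 = 2)

/-- The triangulation `Q_k`. -/
def Qk (k : ℕ) : SimpleGraph (Fin (k + 2) × Fin 4) := SimpleGraph.fromRel (qkRel k)

open SimpleGraph

instance qkRel.decidable (k : ℕ) : DecidableRel (qkRel k) := fun u v => by
  unfold qkRel; infer_instance

instance Qk.decidableAdj (k : ℕ) : DecidableRel (Qk k).Adj := fun u v =>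
  decidable_of_iff (u ≠ v ∧ (qkRel k u v ∨ qkRel k v u)) (SimpleGraph.fromRel_adj _ _ _).symm

theorem SimpleGraph.Reachable.label_eq {W α : Type*} {H : SimpleGraph W} {L : W → α}
    (hadj : ∀ u v, H.Adj u v → L u = L v) {u v : W} (h : H.Reachable u v) : L u = L v := by
  obtain ⟨p⟩ := h
  induction p with
  | nil => rfl
  | cons h _ ih => exact (hadj _ _ h).trans ih

/-- A graph whose components are exactly the fibres of a surjection onto `α` has as many
components as `α` has elements. -/
theorem SimpleGraph.card_connectedComponent_eq_of_label {W α : Type*} (H : SimpleGraph W)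
    (L : W → α) (hadj : ∀ u v, H.Adj u v → L u = L v)
    (hreach : ∀ u v, L u = L v → H.Reachable u v) (hsurj : Function.Surjective L) :
    Nat.card H.ConnectedComponent = Nat.card α := by
  refine Nat.card_eq_of_bijective
    (ConnectedComponent.lift L fun _ _ p _ => Reachable.label_eq hadj ⟨p⟩) ⟨?_, fun a => ?_⟩
  · exact ConnectedComponent.ind₂ fun u v h => ConnectedComponent.sound (hreach u v h)
  · obtain ⟨w, rfl⟩ := hsurj a
    exact ⟨H.connectedComponentMk w, rfl⟩

/-- `G.StepsWithin s k r v` holds if `v` can be reached from `r` in at most `k` steps, every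
step starting in `s`. -/
def SimpleGraph.StepsWithin {V : Type*} (G : SimpleGraph V) (s : V → Prop) : ℕ → V → V → Prop
  | 0, r, v => r = v
  | k + 1, r, v => G.StepsWithin s k r v ∨ ∃ w, (s w ∧ G.Adj w v) ∧ G.StepsWithin s k r w

instance SimpleGraph.StepsWithin.decidable {V : Type*} [Fintype V] [DecidableEq V]
    (G : SimpleGraph V) [DecidableRel G.Adj] (s : V → Prop) [DecidablePred s] :
    ∀ k r v, Decidable (G.StepsWithin s k r v)
  | 0, r, v => inferInstanceAs (Decidable (r = v))
  | k + 1, r, v =>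
    have := SimpleGraph.StepsWithin.decidable G s k r
    inferInstanceAs (Decidable (G.StepsWithin s k r v ∨
      ∃ w, (s w ∧ G.Adj w v) ∧ G.StepsWithin s k r w))

theorem SimpleGraph.StepsWithin.reachable {V : Type*} {G : SimpleGraph V} {s : V → Prop} {k : ℕ}
    {r v : V} (h : G.StepsWithin s k r v) (hr : s r) (hv : s v) :
    (G.induce {v | s v}).Reachable ⟨r, hr⟩ ⟨v, hv⟩ := by
  induction k generalizing v with
  | zero => obtain rfl : r = v := h; rfl
  | succ k ih =>
    obtain h | ⟨w, ⟨hw, hwv⟩, h⟩ := h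
    · exact ih h hv
    · exact (ih h hw).trans (Adj.reachable (by simpa using hwv))

/-- Representatives of the six coloring-partitions of `Q_1`. -/
def q1Coloring (i : Fin 6) (v : Fin (1 + 2) × Fin 4) : Fin 4 :=
  (![![![0, 1, 2, 1], ![2, 3, 0, 3], ![0, 1, 2, 1]],
    ![![0, 1, 2, 1], ![3, 2, 3, 0], ![2, 1, 0, 1]],
    ![![0, 1, 2, 3], ![1, 2, 3, 0], ![2, 3, 0, 1]],
    ![![0, 1, 2, 3], ![2, 3, 0, 1], ![0, 1, 2, 3]],
    ![![0, 1, 2, 3], ![1, 2, 3, 0], ![3, 0, 1, 2]],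
    ![![0, 1, 2, 3], ![2, 3, 0, 1], ![3, 0, 1, 2]]] : Fin 6 → Fin 3 → Fin 4 → Fin 4) i v.1 v.2

/-- The component of `B(Q_1)` containing the classes of `q1Coloring i`. -/
def q1Label : Fin 6 → Fin 3 := ![0, 0, 0, 0, 1, 2]

theorem q1Coloring_proper (i : Fin 6) : IsProperColoring (Qk 1) (q1Coloring i) := by
  have : ∀ i u v, (Qk 1).Adj u v → q1Coloring i u ≠ q1Coloring i v := by decide +kernel
  exact this i

theorem q1Coloring_surjective : ∀ i, Function.Surjective (q1Coloring i) := by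
  unfold Function.Surjective; decide +kernel

theorem q1Coloring_connected : ∀ i x y, x ≠ y →
    ¬ (q1Label i = 0 ∧ (x = 1 ∧ y = 3 ∨ x = 3 ∧ y = 1)) →
    ∃ r, (q1Coloring i r = x ∨ q1Coloring i r = y) ∧
      ∀ v, (q1Coloring i v = x ∨ q1Coloring i v = y) →
        (Qk 1).StepsWithin (fun v => q1Coloring i v = x ∨ q1Coloring i v = y) 5 r v := by
  decide +kernel

set_option synthInstance.maxSize 2000 in
theorem q1Coloring_two_chains : ∀ i, q1Label i = 0 →
    ∃ r, (q1Coloring i r = 1 ∨ q1Coloring i r = 3) ∧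
    ∃ t, (q1Coloring i t = 1 ∨ q1Coloring i t = 3) ∧
      ¬ (Qk 1).StepsWithin (fun v => q1Coloring i v = 1 ∨ q1Coloring i v = 3) 2 r t ∧
      ∀ v, (q1Coloring i v = 1 ∨ q1Coloring i v = 3) →
        ((Qk 1).StepsWithin (fun v => q1Coloring i v = 1 ∨ q1Coloring i v = 3) 2 r v ∨
          (Qk 1).StepsWithin (fun v => q1Coloring i v = 1 ∨ q1Coloring i v = 3) 2 t v) ∧
        ∀ u, (q1Coloring i u = 1 ∨ q1Coloring i u = 3) → (Qk 1).Adj u v →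
          ((Qk 1).StepsWithin (fun v => q1Coloring i v = 1 ∨ q1Coloring i v = 3) 2 r u ↔
            (Qk 1).StepsWithin (fun v => q1Coloring i v = 1 ∨ q1Coloring i v = 3) 2 r v) := by
  decide +kernel

theorem kempeCount_comm {V : Type*} (G : SimpleGraph V) (f : V → Fin 4) (a b : Fin 4) :
    kempeCount G f a b = kempeCount G f b a := by
  have : {v | f v = a ∨ f v = b} = {v | f v = b ∨ f v = a} := Set.ext fun _ => or_comm
  rw [kempeCount, this, kempeCount]

theorem kempeCount_perm_comp {V : Type*} (G : SimpleGraph V) (σ : Equiv.Perm (Fin 4))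
    (f : V → Fin 4) (a b : Fin 4) :
    kempeCount G (σ ∘ f) (σ a) (σ b) = kempeCount G f a b := by
  have : {v | (σ ∘ f) v = σ a ∨ (σ ∘ f) v = σ b} = {v | f v = a ∨ f v = b} :=
    Set.ext fun _ => by simp
  rw [kempeCount, this, kempeCount]

theorem kempeCount_q1Coloring_one_three {i : Fin 6} (hi : q1Label i = 0) :
    kempeCount (Qk 1) (q1Coloring i) 1 3 = 2 := by
  obtain ⟨r, hr, t, ht, hrt, h⟩ := q1Coloring_two_chains i hi
  let R (v : Fin (1 + 2) × Fin 4) : Prop :=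
    (Qk 1).StepsWithin (fun v => q1Coloring i v = 1 ∨ q1Coloring i v = 3) 2 r v
  have hRt : ∀ v, (q1Coloring i v = 1 ∨ q1Coloring i v = 3) → ¬ R v →
      (Qk 1).StepsWithin (fun v => q1Coloring i v = 1 ∨ q1Coloring i v = 3) 2 t v :=
    fun v hv hR => (h v hv).1.resolve_left hR
  refine (card_connectedComponent_eq_of_label _
    (fun v : {v | q1Coloring i v = 1 ∨ q1Coloring i v = 3} => R v)
    (fun u v huv => propext ((h v v.2).2 u u.2 huv)) (fun u v huv => ?_) fun p => ?_).trans
    (by simp : Nat.card Prop = 2)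
  · by_cases hu : R u
    · exact (hu.reachable hr u.2).symm.trans ((huv.mp hu).reachable hr v.2)
    · exact ((hRt u u.2 hu).reachable ht u.2).symm.trans
        ((hRt v v.2 (mt huv.mpr hu)).reachable ht v.2)
  · by_cases hp : p
    · exact ⟨⟨r, hr⟩, by simp [R, hp, StepsWithin]⟩
    · exact ⟨⟨t, ht⟩, by simp [R, hp, hrt]⟩

theorem kempeCount_q1Coloring (i : Fin 6) (x y : Fin 4) (hxy : x ≠ y) :
    kempeCount (Qk 1) (q1Coloring i) x y =
      if q1Label i = 0 ∧ (x = 1 ∧ y = 3 ∨ x = 3 ∧ y = 1) then 2 else 1 := by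
  split_ifs with h
  · obtain ⟨hi, ⟨rfl, rfl⟩ | ⟨rfl, rfl⟩⟩ := h
    · exact kempeCount_q1Coloring_one_three hi
    · rw [kempeCount_comm, kempeCount_q1Coloring_one_three hi]
  · obtain ⟨r, hr, hcov⟩ := q1Coloring_connected i x y hxy h
    refine (card_connectedComponent_eq_of_label _ (fun _ => ()) (fun _ _ _ => rfl)
      (fun u v _ => ?_) fun _ => ⟨⟨r, hr⟩, rfl⟩).trans (by simp)
    exact ((hcov u u.2).reachable hr u.2).symm.trans ((hcov v v.2).reachable hr v.2)

/-- The parity of `J_a` does not depend on `a`: it is that of the total number of Kempe chains. -/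
theorem exists_two_mul_Jcol_add {V : Type*} (G : SimpleGraph V) (f : V → Fin 4) (a : Fin 4) :
    ∃ m : ℤ, 2 * Jcol G f a + 4 * m =
      ∑ x, ∑ y, if x = y then 0 else (kempeCount G f x y : ℤ) := by
  refine ⟨∑ x ∈ Finset.univ.erase a,
      ∑ y ∈ (Finset.univ.erase a).filter (fun y => x < y), (kempeCount G f x y : ℤ), ?_⟩
  have e0 : (Finset.univ : Finset (Fin 4)).erase 0 = {1, 2, 3} := by decide
  have e1 : (Finset.univ : Finset (Fin 4)).erase 1 = {0, 2, 3} := by decide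
  have e2 : (Finset.univ : Finset (Fin 4)).erase 2 = {0, 1, 3} := by decide
  have e3 : (Finset.univ : Finset (Fin 4)).erase 3 = {0, 1, 2} := by decide
  fin_cases a <;>
    simp [Jcol, e0, e1, e2, e3, Fin.sum_univ_four, Finset.sum_filter, kempeCount_comm G f 1 0,
      kempeCount_comm G f 2 0, kempeCount_comm G f 3 0, kempeCount_comm G f 2 1,
      kempeCount_comm G f 3 1, kempeCount_comm G f 3 2] <;> ring

/-- Two surjective colorings with the same color classes differ by a permutation of colors. -/
theorem exists_perm_comp_eq {V α : Type*} [Finite α] {f g : V → α} (hg : Function.Surjective g)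
    (h : ∀ u v, f u = f v ↔ g u = g v) : ∃ σ : Equiv.Perm α, f = σ ∘ g := by
  let τ : α → α := fun c => f (Function.surjInv hg c)
  have hτ : Function.Injective τ := fun c d hcd => by
    simpa [Function.surjInv_eq] using (h _ _).mp hcd
  refine ⟨Equiv.ofBijective τ (Finite.injective_iff_bijective.mp hτ), funext fun v => ?_⟩
  exact (h _ _).mpr (Function.surjInv_eq hg _).symm

theorem Jcol_q1_parity {f : Fin (1 + 2) × Fin 4 → Fin 4} {i : Fin 6}
    (h : ∀ u v, f u = f v ↔ q1Coloring i u = q1Coloring i v) (a : Fin 4) :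
    Odd (Jcol (Qk 1) f a) ↔ q1Label i = 0 := by
  obtain ⟨σ, rfl⟩ := exists_perm_comp_eq (q1Coloring_surjective i) h
  obtain ⟨m, hm⟩ := exists_two_mul_Jcol_add (Qk 1) (σ ∘ q1Coloring i) a
  rw [← Equiv.sum_comp σ] at hm
  simp_rw [← Equiv.sum_comp σ (fun y => if σ _ = y then _ else _), kempeCount_perm_comp,
    EmbeddingLike.apply_eq_iff_eq] at hm
  have hsum : (∑ x, ∑ y, if x = y then 0 else (kempeCount (Qk 1) (q1Coloring i) x y : ℤ)) =
      if q1Label i = 0 then 14 else 12 := by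
    simp only [Fin.sum_univ_four]
    simp [kempeCount_q1Coloring]
    split_ifs <;> norm_num
  rw [hsum] at hm
  rw [Int.odd_iff]
  split_ifs at hm <;> simp_all <;> omega

set_option synthInstance.maxSize 2000 in
/-- Every proper 4-coloring of `Q_1` has the same color classes as one of the `q1Coloring i`. -/
theorem exists_q1Coloring {f : Fin (1 + 2) × Fin 4 → Fin 4} (hf : IsProperColoring (Qk 1) f) :
    ∃ i, ∀ u v, f u = f v ↔ q1Coloring i u = q1Coloring i v := by
  have key :
      ∀ a0 b0, b0 ≠ a0 →
      ∀ c0, c0 ≠ a0 ∧ c0 ≠ b0 →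
      ∀ d0, d0 ≠ a0 ∧ d0 ≠ c0 →
      ∀ a1, a1 ≠ a0 ∧ a1 ≠ d0 →
      ∀ b1, b1 ≠ a0 ∧ b1 ≠ b0 ∧ b1 ≠ a1 →
      ∀ c1, c1 ≠ b0 ∧ c1 ≠ c0 ∧ c1 ≠ b1 →
      ∀ d1, d1 ≠ c0 ∧ d1 ≠ d0 ∧ d1 ≠ a1 ∧ d1 ≠ c1 →
      ∀ a2, a2 ≠ a1 ∧ a2 ≠ d1 →
      ∀ b2, b2 ≠ a1 ∧ b2 ≠ b1 ∧ b2 ≠ a2 →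
      ∀ c2, c2 ≠ b1 ∧ c2 ≠ c1 ∧ c2 ≠ a2 ∧ c2 ≠ b2 →
      ∀ d2, d2 ≠ c1 ∧ d2 ≠ d1 ∧ d2 ≠ a2 ∧ d2 ≠ c2 →
      ∃ i e, Function.Injective ![a0, b0, c0, e] ∧ ∀ u : Fin (1 + 2) × Fin 4,
        (![![a0, b0, c0, d0], ![a1, b1, c1, d1], ![a2, b2, c2, d2]] :
          Fin 3 → Fin 4 → Fin 4) u.1 u.2 = ![a0, b0, c0, e] (q1Coloring i u) := by
    unfold Function.Injective
    decide +kernel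
  have hM : ∀ u : Fin (1 + 2) × Fin 4,
      (![![f (0, 0), f (0, 1), f (0, 2), f (0, 3)], ![f (1, 0), f (1, 1), f (1, 2), f (1, 3)],
        ![f (2, 0), f (2, 1), f (2, 2), f (2, 3)]] : Fin 3 → Fin 4 → Fin 4) u.1 u.2 = f u := by
    rintro ⟨a, b⟩
    fin_cases a <;> fin_cases b <;> rfl
  obtain ⟨i, e, he, h⟩ := key
    (f (0, 0)) (f (0, 1)) (hf (by decide)) (f (0, 2)) ⟨hf (by decide), hf (by decide)⟩
    (f (0, 3)) ⟨hf (by decide), hf (by decide)⟩ (f (1, 0)) ⟨hf (by decide), hf (by decide)⟩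
    (f (1, 1)) ⟨hf (by decide), hf (by decide), hf (by decide)⟩
    (f (1, 2)) ⟨hf (by decide), hf (by decide), hf (by decide)⟩
    (f (1, 3)) ⟨hf (by decide), hf (by decide), hf (by decide), hf (by decide)⟩
    (f (2, 0)) ⟨hf (by decide), hf (by decide)⟩
    (f (2, 1)) ⟨hf (by decide), hf (by decide), hf (by decide)⟩
    (f (2, 2)) ⟨hf (by decide), hf (by decide), hf (by decide), hf (by decide)⟩
    (f (2, 3)) ⟨hf (by decide), hf (by decide), hf (by decide), hf (by decide)⟩
  simp only [hM] at h
  exact ⟨i, fun u v => by rw [h u, h v, he.eq_iff]⟩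

theorem preimage_mem_colorClasses {V : Type*} {G : SimpleGraph V} {f : V → Fin 4}
    (hf : IsProperColoring G f) (u : V) : f ⁻¹' {f u} ∈ colorClasses G :=
  ⟨⟨u, rfl⟩, f, f u, hf, rfl⟩

/-- The color class of `q1Coloring i` containing `u`, as a vertex of `B(Q_1)`. -/
def q1Class (i : Fin 6) (u : Fin (1 + 2) × Fin 4) : colorClasses (Qk 1) :=
  ⟨q1Coloring i ⁻¹' {q1Coloring i u}, preimage_mem_colorClasses (q1Coloring_proper i) u⟩

theorem mem_q1Class {i : Fin 6} {u v : Fin (1 + 2) × Fin 4} :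
    v ∈ (q1Class i u : Set (Fin (1 + 2) × Fin 4)) ↔ q1Coloring i v = q1Coloring i u := Iff.rfl

theorem q1Class_eq_of_mem_colPart {f : Fin (1 + 2) × Fin 4 → Fin 4} {i : Fin 6}
    (h : ∀ u v, f u = f v ↔ q1Coloring i u = q1Coloring i v) {A : colorClasses (Qk 1)}
    (hA : (A : Set (Fin (1 + 2) × Fin 4)) ∈ colPart f) : ∃ u, A = q1Class i u := by
  obtain ⟨⟨u, hu⟩, c, hc⟩ := hA
  obtain rfl : f u = c := by simpa [hc] using hu
  exact ⟨u, Subtype.ext (hc.trans (Set.ext fun v => h v u))⟩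

theorem exists_eq_q1Class (A : colorClasses (Qk 1)) : ∃ p : Fin 6 × (Fin (1 + 2) × Fin 4),
    A = q1Class p.1 p.2 := by
  obtain ⟨hne, f, c, hf, hc⟩ := A.2
  obtain ⟨i, hi⟩ := exists_q1Coloring hf
  obtain ⟨u, hu⟩ := q1Class_eq_of_mem_colPart hi ⟨hne, c, hc⟩
  exact ⟨(i, u), hu⟩

theorem q1Label_eq_of_q1Class_eq {i j : Fin 6} {u w : Fin (1 + 2) × Fin 4}
    (h : q1Class i u = q1Class j w) : q1Label i = q1Label j := by
  have key : ∀ i j u, (∀ v, q1Coloring i v = q1Coloring i u ↔ q1Coloring j v = q1Coloring j u) →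
      q1Label i = q1Label j := by decide +kernel
  have hmem (v) : q1Coloring i v = q1Coloring i u ↔ q1Coloring j v = q1Coloring j w := by
    rw [← mem_q1Class, h, mem_q1Class]
  exact key i j u fun v => by rw [hmem, (hmem u).mp rfl]

/-- The label of the coloring-partitions containing a given color class of `Q_1`. -/
noncomputable def q1ClassLabel (A : colorClasses (Qk 1)) : Fin 3 :=
  q1Label (exists_eq_q1Class A).choose.1

theorem q1ClassLabel_q1Class (i : Fin 6) (u : Fin (1 + 2) × Fin 4) :
    q1ClassLabel (q1Class i u) = q1Label i :=
  (q1Label_eq_of_q1Class_eq (exists_eq_q1Class (q1Class i u)).choose_spec).symm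

theorem q1ClassLabel_eq_of_adj {A B : colorClasses (Qk 1)} (h : (colorComplex (Qk 1)).Adj A B) :
    q1ClassLabel A = q1ClassLabel B := by
  have key {A B : colorClasses (Qk 1)} (h : ∃ f, IsProperColoring (Qk 1) f ∧
      (∃ c, (A : Set (Fin (1 + 2) × Fin 4)) = f ⁻¹' {c}) ∧
      (∃ c, (B : Set (Fin (1 + 2) × Fin 4)) = f ⁻¹' {c})) : q1ClassLabel A = q1ClassLabel B := by
    obtain ⟨f, hf, hA, hB⟩ := h
    obtain ⟨i, hi⟩ := exists_q1Coloring hf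
    obtain ⟨u, rfl⟩ := q1Class_eq_of_mem_colPart hi ⟨A.2.1, hA⟩
    obtain ⟨w, rfl⟩ := q1Class_eq_of_mem_colPart hi ⟨B.2.1, hB⟩
    rw [q1ClassLabel_q1Class, q1ClassLabel_q1Class]
  obtain ⟨-, h | h⟩ := (SimpleGraph.fromRel_adj _ _ _).mp h
  · exact key h
  · exact (key h).symm

theorem q1Class_reachable (i : Fin 6) (u w : Fin (1 + 2) × Fin 4) :
    (colorComplex (Qk 1)).Reachable (q1Class i u) (q1Class i w) := by
  by_cases h : q1Class i u = q1Class i w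
  · rw [h]
  · exact Adj.reachable ((SimpleGraph.fromRel_adj _ _ _).mpr
      ⟨h, .inl ⟨_, q1Coloring_proper i, ⟨_, rfl⟩, ⟨_, rfl⟩⟩⟩)

theorem q1Class_reachable_of_label_eq {i j : Fin 6} (h : q1Label i = q1Label j)
    (u w : Fin (1 + 2) × Fin 4) :
    (colorComplex (Qk 1)).Reachable (q1Class i u) (q1Class j w) := by
  have key : ∀ i j, q1Label i = q1Label j → ∃ k l,
      (∃ u, ∀ v, q1Coloring i v = q1Coloring i u ↔ q1Coloring k v = q1Coloring k u) ∧
      (∃ u, ∀ v, q1Coloring k v = q1Coloring k u ↔ q1Coloring l v = q1Coloring l u) ∧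
      ∃ u, ∀ v, q1Coloring l v = q1Coloring l u ↔ q1Coloring j v = q1Coloring j u := by
    decide +kernel
  have step {i j : Fin 6}
      (h : ∃ u, ∀ v, q1Coloring i v = q1Coloring i u ↔ q1Coloring j v = q1Coloring j u)
      (u w : Fin (1 + 2) × Fin 4) :
      (colorComplex (Qk 1)).Reachable (q1Class i u) (q1Class j w) := by
    obtain ⟨t, ht⟩ := h
    have : q1Class i t = q1Class j t := Subtype.ext (Set.ext ht)
    exact (q1Class_reachable i u t).trans (this ▸ q1Class_reachable j t w)
  obtain ⟨k, l, hik, hkl, hlj⟩ := key i j h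
  exact ((step hik u u).trans (step hkl u u)).trans (step hlj u w)

theorem reachable_of_q1ClassLabel_eq {A B : colorClasses (Qk 1)}
    (h : q1ClassLabel A = q1ClassLabel B) : (colorComplex (Qk 1)).Reachable A B := by
  obtain ⟨⟨i, u⟩, rfl⟩ := exists_eq_q1Class A
  obtain ⟨⟨j, w⟩, rfl⟩ := exists_eq_q1Class B
  rw [q1ClassLabel_q1Class, q1ClassLabel_q1Class] at h
  exact q1Class_reachable_of_label_eq h u w

theorem q1ClassLabel_surjective : Function.Surjective q1ClassLabel := fun l => by
  have key : ∀ l, ∃ i, q1Label i = l := by decide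
  obtain ⟨i, rfl⟩ := key l
  exact ⟨q1Class i 0, q1ClassLabel_q1Class i 0⟩

/-- `B(Q_1)` has exactly three connected components; the proper 4-colorings whose color
classes all lie in one distinguished component are all odd, and the proper 4-colorings
whose color classes all lie in any of the other two components are all even. -/
theorem colorComplex_Q1_three_components :
    Nat.card ((colorComplex (Qk 1)).ConnectedComponent) = 3 ∧
    ∃ K : (colorComplex (Qk 1)).ConnectedComponent,
      ∀ f : Fin (1 + 2) × Fin 4 → Fin 4, IsProperColoring (Qk 1) f →
        ((∀ A : colorClasses (Qk 1), (A : Set (Fin (1 + 2) × Fin 4)) ∈ colPart f →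
            (colorComplex (Qk 1)).connectedComponentMk A = K) →
          ∀ a, Odd (Jcol (Qk 1) f a)) ∧
        (∀ K', K' ≠ K →
          (∀ A : colorClasses (Qk 1), (A : Set (Fin (1 + 2) × Fin 4)) ∈ colPart f →
            (colorComplex (Qk 1)).connectedComponentMk A = K') →
          ∀ a, Even (Jcol (Qk 1) f a)) := by
  refine ⟨(card_connectedComponent_eq_of_label _ q1ClassLabel
    (fun _ _ => q1ClassLabel_eq_of_adj) (fun _ _ => reachable_of_q1ClassLabel_eq)
    q1ClassLabel_surjective).trans (by simp),
    (colorComplex (Qk 1)).connectedComponentMk (q1Class 0 0), fun f hf => ?_⟩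
  obtain ⟨i, hi⟩ := exists_q1Coloring hf
  have hmem : (q1Class i 0 : Set (Fin (1 + 2) × Fin 4)) ∈ colPart f :=
    ⟨⟨0, rfl⟩, f 0, Set.ext fun v => (hi v 0).symm⟩
  refine ⟨fun h a => ?_, fun K' hK' h a => ?_⟩
  · rw [Jcol_q1_parity hi, ← q1ClassLabel_q1Class i 0, show (0 : Fin 3) = q1Label 0 from rfl,
      ← q1ClassLabel_q1Class 0 0]
    exact Reachable.label_eq (fun _ _ => q1ClassLabel_eq_of_adj)
      (ConnectedComponent.exact (h _ hmem))
  · rw [← Int.not_odd_iff_even, Jcol_q1_parity hi]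
    intro hl
    exact hK' ((h _ hmem).symm.trans
      (ConnectedComponent.sound (q1Class_reachable_of_label_eq hl 0 0)))
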